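/- arXiv:2212.12655 — 4 statements merged into one kernel-verified Lean document; each statement's English description precedes it below -/
import Mathlib

section
/- Let m ≥ 1 and r ≥ 2 be integers, let n = r·2^m, and suppose I is an independent set of the Birkhoff polytope graph G(Ω_r) all of whose elements are even permutations. Then the independence number α(n) of G(Ω_n) satisfies α(n) ≥ |I| · 2^m · ∏_{k=0}^{m−1} (r·2^k)!. -/
/-- An independent set of the Birkhoff polytope graph `G(Ω_n)`: a set of pairwise
non-adjacent permutations, where `σ`, `τ` are adjacent iff `σ⁻¹ * τ` is a cycle. -/
def IsBIndep {n : ℕ} (S : Set (Equiv.Perm (Fin n))) : Prop :=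
  S.Pairwise fun σ τ => ¬ (σ⁻¹ * τ).IsCycle

/-- The independence number `α(n)` of the Birkhoff polytope graph `G(Ω_n)`. -/
noncomputable def birkhoffIndepNum (n : ℕ) : ℕ :=
  sSup {k | ∃ S : Finset (Equiv.Perm (Fin n)),
    IsBIndep (S : Set (Equiv.Perm (Fin n))) ∧ S.card = k}

open Equiv Equiv.Perm in
theorem aux_zpow {α β : Type*} (a : Perm α) (b : Perm β) (k : ℤ) :
    (Equiv.Perm.sumCongr a b) ^ k = Equiv.Perm.sumCongr (a ^ k) (b ^ k) := by
  have := map_zpow (Equiv.Perm.sumCongrHom α β) (a, b) k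
  simpa using this.symm

open Equiv Equiv.Perm in
theorem aux_sum {α β : Type*} (a : Perm α) (b : Perm β)
    (h : (Equiv.Perm.sumCongr a b).IsCycle) :
    (a = 1 ∧ b.IsCycle) ∨ (b = 1 ∧ a.IsCycle) := by
  obtain ⟨x, hx, hy⟩ := h
  rcases x with u | u
  · right
    refine ⟨?_, u, by simpa using hx, ?_⟩
    · ext v
      by_contra hv
      obtain ⟨k, hk⟩ := hy (y := Sum.inr v) (by simpa using hv)
      rw [aux_zpow] at hk
      simp at hk
    · intro v hv
      obtain ⟨k, hk⟩ := hy (y := Sum.inl v) (by simpa using hv)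
      rw [aux_zpow] at hk
      exact ⟨k, by simpa using hk⟩
  · left
    refine ⟨?_, u, by simpa using hx, ?_⟩
    · ext v
      by_contra hv
      obtain ⟨k, hk⟩ := hy (y := Sum.inl v) (by simpa using hv)
      rw [aux_zpow] at hk
      simp at hk
    · intro v hv
      obtain ⟨k, hk⟩ := hy (y := Sum.inr v) (by simpa using hv)
      rw [aux_zpow] at hk
      exact ⟨k, by simpa using hk⟩

open Equiv Equiv.Perm in
theorem aux_swap {α : Type*} [Fintype α] [DecidableEq α] (hc : 2 ≤ Fintype.card α) :
    ∃ c : Perm (α ⊕ α), Equiv.Perm.sign c = 1 ∧ ∀ x, (c x).isLeft = !x.isLeft := by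
  rcases Int.units_eq_one_or (Equiv.Perm.sign (Equiv.sumComm α α : Perm (α ⊕ α))) with h | h
  · exact ⟨Equiv.sumComm α α, h, by rintro (x | x) <;> simp⟩
  · obtain ⟨x, y, hxy⟩ := Fintype.one_lt_card_iff.mp hc
    refine ⟨(Equiv.sumComm α α : Perm (α ⊕ α)) * Equiv.Perm.sumCongr (Equiv.swap x y) 1, ?_, ?_⟩
    · rw [Equiv.Perm.sign_mul, h, Equiv.Perm.sign_sumCongr, Equiv.Perm.sign_swap hxy]
      simp
    · rintro (x | x) <;> rfl

open Equiv Equiv.Perm in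
theorem aux_full {α : Type*} [Fintype α] [DecidableEq α] (g : Perm (α ⊕ α))
    (hs : Equiv.Perm.sign g = 1) (hg : ∀ x, (g x).isLeft = !x.isLeft) : ¬ g.IsCycle := by
  intro h
  have h1 := h.sign
  have h2 : g.support = Finset.univ := by
    ext x
    simp only [Equiv.Perm.mem_support, Finset.mem_univ, iff_true]
    intro hx
    have := hg x
    rw [hx] at this
    cases h : x.isLeft <;> simp_all
  rw [h2, hs, Finset.card_univ, Fintype.card_sum, Even.neg_one_pow ⟨_, rfl⟩] at h1
  exact absurd h1 (by decide)

theorem aux_left {α : Type*} (a b : Equiv.Perm α) (x : α ⊕ α) :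
    (Equiv.Perm.sumCongr a b x).isLeft = x.isLeft := by
  rcases x with x | x <;> simp

theorem aux_sub {α : Type*} (a b c d : Equiv.Perm α) :
    (Equiv.Perm.sumCongr a b)⁻¹ * Equiv.Perm.sumCongr c d
      = Equiv.Perm.sumCongr (a⁻¹ * c) (b⁻¹ * d) := by
  rw [Equiv.Perm.sumCongr_inv, Equiv.Perm.sumCongr_mul]

/-- same half -/
theorem aux_same {α : Type*} [Fintype α] [DecidableEq α] (I : Finset (Equiv.Perm α))
    (hI : (I : Set (Equiv.Perm α)).Pairwise fun σ τ => ¬ (σ⁻¹ * τ).IsCycle)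
    (i j p q : Equiv.Perm α) (hi : i ∈ I) (hj : j ∈ I) :
    ¬ ((Equiv.Perm.sumCongr p (p * i))⁻¹ * Equiv.Perm.sumCongr q (q * j)).IsCycle := by
  have key : ∀ i ∈ I, ∀ j ∈ I, ¬ (i⁻¹ * j).IsCycle := by
    intro i hi j hj
    by_cases hij : i = j
    · subst hij
      simp
    · exact hI hi hj hij
  intro h
  rw [aux_sub] at h
  rcases aux_sum _ _ h with ⟨h1, h2⟩ | ⟨h1, h2⟩
  · have : p = q := inv_mul_eq_one.mp h1
    subst this
    apply key i hi j hj
    convert h2 using 1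
    group
  · have h3 : p * i = q * j := inv_mul_eq_one.mp h1
    have h4 : p⁻¹ * q = j * (j⁻¹ * i) * j⁻¹ := by
      have : q = p * i * j⁻¹ := by rw [h3]; group
      rw [this]; group
    rw [h4] at h2
    apply key j hj i hi
    have := h2.conj (g := j⁻¹)
    convert this using 1
    group

theorem aux_double {α : Type*} [Fintype α] [DecidableEq α] (hc : 2 ≤ Fintype.card α)
    (I : Finset (Equiv.Perm α))
    (hI : (I : Set (Equiv.Perm α)).Pairwise fun σ τ => ¬ (σ⁻¹ * τ).IsCycle)
    (he : ∀ σ ∈ I, Equiv.Perm.sign σ = 1) :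
    ∃ J : Finset (Equiv.Perm (α ⊕ α)),
      ((J : Set (Equiv.Perm (α ⊕ α))).Pairwise fun σ τ => ¬ (σ⁻¹ * τ).IsCycle) ∧
      (∀ σ ∈ J, Equiv.Perm.sign σ = 1) ∧
      J.card = I.card * 2 * (Fintype.card α).factorial := by
  classical
  obtain ⟨c, hc1, hc2⟩ := aux_swap hc
  let f : Equiv.Perm α × Equiv.Perm α → Equiv.Perm (α ⊕ α) :=
    fun x => Equiv.Perm.sumCongr x.2 (x.2 * x.1)
  have hf : Function.Injective f := by
    rintro ⟨i, p⟩ ⟨j, q⟩ h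
    have h' : Equiv.Perm.sumCongrHom α α (p, p * i) = Equiv.Perm.sumCongrHom α α (q, q * j) := h
    have := Equiv.Perm.sumCongrHom_injective h'
    simp only [Prod.mk.injEq] at this
    obtain ⟨rfl, h2⟩ := this
    simpa using h2
  have hsf : ∀ x, x.1 ∈ I → Equiv.Perm.sign (f x) = 1 := by
    intro x hx
    simp [f, Equiv.Perm.sign_sumCongr, he _ hx, Int.units_mul_self]
  have hlf : ∀ x y, ((f x) y).isLeft = y.isLeft := fun x y => aux_left _ _ _
  have hlf' : ∀ x y, ((f x)⁻¹ y).isLeft = y.isLeft := by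
    intro x y
    have := hlf x ((f x)⁻¹ y)
    simpa using this.symm
  have hcross : ∀ x y, x.1 ∈ I → y.1 ∈ I → ¬ ((f x)⁻¹ * (f y * c)).IsCycle := by
    intro x y hx hy
    apply aux_full
    · simp [hsf x hx, hsf y hy, hc1]
    · intro z
      simp only [Equiv.Perm.mul_apply]
      rw [hlf', hlf, hc2]
  let A := (I ×ˢ (Finset.univ : Finset (Equiv.Perm α))).image f
  have hA : ∀ g ∈ A, ∃ x, x.1 ∈ I ∧ f x = g := by
    intro g hg
    simp only [A, Finset.mem_image, Finset.mem_product, Finset.mem_univ, and_true] at hg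
    exact hg
  have hAc : A.card = I.card * (Fintype.card α).factorial := by
    rw [Finset.card_image_of_injective _ hf, Finset.card_product, Finset.card_univ,
      Fintype.card_perm]
  let B := A.image (fun g => g * c)
  have hB : ∀ g ∈ B, ∃ x, x.1 ∈ I ∧ f x * c = g := by
    intro g hg
    obtain ⟨a, ha, rfl⟩ := Finset.mem_image.mp hg
    obtain ⟨x, hx, rfl⟩ := hA a ha
    exact ⟨x, hx, rfl⟩
  have hBc : B.card = A.card := Finset.card_image_of_injective _ (mul_left_injective c)
  have hdis : Disjoint A B := by
    rw [Finset.disjoint_left]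
    intro g hgA hgB
    obtain ⟨x, hx, rfl⟩ := hA g hgA
    obtain ⟨y, hy, h⟩ := hB _ hgB
    obtain ⟨z, -⟩ := Fintype.one_lt_card_iff.mp hc
    have h1 := hlf x (Sum.inl z)
    rw [← h, Equiv.Perm.mul_apply, hlf, hc2] at h1
    simp at h1
  refine ⟨A ∪ B, ?_, ?_, ?_⟩
  · intro g hg k hk hne
    rw [Finset.mem_coe, Finset.mem_union] at hg hk
    rcases hg with hg | hg <;> rcases hk with hk | hk
    · obtain ⟨x, hx, rfl⟩ := hA _ hg
      obtain ⟨y, hy, rfl⟩ := hA _ hk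
      exact aux_same I hI _ _ _ _ hx hy
    · obtain ⟨x, hx, rfl⟩ := hA _ hg
      obtain ⟨y, hy, rfl⟩ := hB _ hk
      exact hcross x y hx hy
    · obtain ⟨x, hx, rfl⟩ := hB _ hg
      obtain ⟨y, hy, rfl⟩ := hA _ hk
      intro h
      apply hcross y x hy hx
      convert h.inv using 1
      group
    · obtain ⟨x, hx, rfl⟩ := hB _ hg
      obtain ⟨y, hy, rfl⟩ := hB _ hk
      intro h
      apply aux_same I hI x.1 y.1 x.2 y.2 hx hy
      have := h.conj (g := c)
      convert this using 1
      change (f x)⁻¹ * f y = _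
      group
  · intro g hg
    rcases Finset.mem_union.mp hg with hg | hg
    · obtain ⟨x, hx, rfl⟩ := hA _ hg
      exact hsf x hx
    · obtain ⟨x, hx, rfl⟩ := hB _ hg
      simp [hsf x hx, hc1]
  · rw [Finset.card_union_of_disjoint hdis, hBc, hAc]
    ring

theorem aux_cyc {α β : Type*} (e : α ≃ β) (g : Equiv.Perm α)
    (h : (e.permCongrHom g).IsCycle) : g.IsCycle := by
  obtain ⟨x, hx, hy⟩ := h
  refine ⟨e.symm x, ?_, ?_⟩
  · intro h
    apply hx
    simp [Equiv.permCongr_apply, h]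
  · intro y hyy
    obtain ⟨k, hk⟩ := hy (y := e y) (by simpa [Equiv.permCongr_apply] using hyy)
    refine ⟨k, ?_⟩
    rw [← map_zpow] at hk
    simpa [Equiv.permCongr_apply] using hk

theorem aux_transfer {α β : Type*} [Fintype α] [DecidableEq α] [Fintype β] [DecidableEq β]
    (e : α ≃ β) (I : Finset (Equiv.Perm α))
    (hI : (I : Set (Equiv.Perm α)).Pairwise fun σ τ => ¬ (σ⁻¹ * τ).IsCycle)
    (he : ∀ σ ∈ I, Equiv.Perm.sign σ = 1) :
    ∃ J : Finset (Equiv.Perm β),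
      ((J : Set (Equiv.Perm β)).Pairwise fun σ τ => ¬ (σ⁻¹ * τ).IsCycle) ∧
      (∀ σ ∈ J, Equiv.Perm.sign σ = 1) ∧ J.card = I.card := by
  classical
  refine ⟨I.image e.permCongrHom, ?_, ?_,
    Finset.card_image_of_injective _ e.permCongrHom.injective⟩
  · intro a ha b hb hab h
    rw [Finset.mem_coe, Finset.mem_image] at ha hb
    obtain ⟨a, ha, rfl⟩ := ha
    obtain ⟨b, hb, rfl⟩ := hb
    rw [← map_inv, ← map_mul] at h
    exact hI ha hb (fun hh => hab (by rw [hh])) (aux_cyc e _ h)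
  · intro a ha
    obtain ⟨b, hb, rfl⟩ := Finset.mem_image.mp ha
    have := he b hb
    simpa [Equiv.Perm.sign_permCongr] using this

theorem aux_main (m r : ℕ) (hr : 2 ≤ r) (I : Finset (Equiv.Perm (Fin r)))
    (hI : (I : Set (Equiv.Perm (Fin r))).Pairwise fun σ τ => ¬ (σ⁻¹ * τ).IsCycle)
    (he : ∀ σ ∈ I, Equiv.Perm.sign σ = 1) :
    ∃ J : Finset (Equiv.Perm (Fin (r * 2 ^ m))),
      ((J : Set (Equiv.Perm (Fin (r * 2 ^ m)))).Pairwise fun σ τ => ¬ (σ⁻¹ * τ).IsCycle) ∧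
      (∀ σ ∈ J, Equiv.Perm.sign σ = 1) ∧
      J.card = I.card * 2 ^ m * ∏ j ∈ Finset.range m, (r * 2 ^ j).factorial := by
  induction m with
  | zero =>
    obtain ⟨J, h1, h2, h3⟩ := aux_transfer (finCongr (by simp : r = r * 2 ^ 0)) I hI he
    exact ⟨J, h1, h2, by simpa using h3⟩
  | succ m ih =>
    obtain ⟨J, h1, h2, h3⟩ := ih
    have hcard : 2 ≤ Fintype.card (Fin (r * 2 ^ m)) := by
      rw [Fintype.card_fin]
      exact hr.trans (Nat.le_mul_of_pos_right _ (by positivity))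
    obtain ⟨K, k1, k2, k3⟩ := aux_double hcard J h1 h2
    obtain ⟨L, l1, l2, l3⟩ := aux_transfer
      (finSumFinEquiv.trans (finCongr (by ring : r * 2 ^ m + r * 2 ^ m = r * 2 ^ (m + 1)))) K k1 k2
    refine ⟨L, l1, l2, ?_⟩
    rw [l3, k3, h3, Finset.prod_range_succ, Fintype.card_fin]
    ring

/-- Corollary 4.5: for `n = r·2^m` (`m ≥ 1`, `r ≥ 2`), if `I` is an independent set of
`G(Ω_r)` of even permutations, then `α(n) ≥ |I|·2^m·∏_{j=0}^{m-1} (r·2^j)!`. -/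
theorem stmt16 (m r : ℕ) (hm : 1 ≤ m) (hr : 2 ≤ r)
    (I : Finset (Equiv.Perm (Fin r)))
    (hI : IsBIndep (I : Set (Equiv.Perm (Fin r))))
    (heven : ∀ σ ∈ I, Equiv.Perm.sign σ = 1) :
    I.card * 2 ^ m * ∏ j ∈ Finset.range m, (r * 2 ^ j).factorial ≤
      birkhoffIndepNum (r * 2 ^ m) := by
  obtain ⟨J, h1, -, h3⟩ := aux_main m r hr I hI heven
  refine le_csSup ⟨Fintype.card (Equiv.Perm (Fin (r * 2 ^ m))), ?_⟩ ⟨J, h1, h3⟩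
  rintro k ⟨S, -, rfl⟩
  exact Finset.card_le_univ S
end

section
/- Let m ≥ 2 and n = 2^m. Then there exists an independent set B of the Birkhoff polytope graph G(Ω_n) consisting entirely of even permutations such that |B| ≥ n^{(6 + log₂ n)/4} · n!/2^{2n−1} = 2·n^{(6 + log₂ n)/4} · n!/4^n. -/
open Equiv Equiv.Perm

/-- Generic version over an arbitrary finite type. -/
def GoodFam (α : Type) [Fintype α] [DecidableEq α] (k : ℕ) : Prop :=
  ∃ B : Finset (Perm α), (∀ σ ∈ B, ∀ τ ∈ B, σ ≠ τ → ¬ (σ⁻¹ * τ).IsCycle) ∧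
    (∀ σ ∈ B, sign σ = 1) ∧ B.card = k

lemma sumCongr_zpow_apply {α : Type} (x y : Perm α) (i : ℤ) :
    (Perm.sumCongr x y) ^ i = Perm.sumCongr (x ^ i) (y ^ i) := by
  have := map_zpow (sumCongrHom α α) (x, y) i
  exact this.symm

lemma not_isCycle_sumCongr {α : Type} {x y : Perm α} (h : (Perm.sumCongr x y).IsCycle) :
    (x = 1 ∧ y.IsCycle) ∨ (y = 1 ∧ x.IsCycle) := by
  obtain ⟨z, hz, hw⟩ := h
  rcases z with a | a
  · right
    refine ⟨?_, a, by simpa using hz, ?_⟩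
    · ext b
      by_contra hb
      obtain ⟨i, hi⟩ := hw (y := Sum.inr b) (by simpa using hb)
      rw [sumCongr_zpow_apply] at hi
      simp at hi
    · intro b hb
      obtain ⟨i, hi⟩ := hw (y := Sum.inl b) (by simpa using hb)
      rw [sumCongr_zpow_apply] at hi
      exact ⟨i, by simpa using hi⟩
  · left
    refine ⟨?_, a, by simpa using hz, ?_⟩
    · ext b
      by_contra hb
      obtain ⟨i, hi⟩ := hw (y := Sum.inl b) (by simpa using hb)
      rw [sumCongr_zpow_apply] at hi
      simp at hi
    · intro b hb
      obtain ⟨i, hi⟩ := hw (y := Sum.inr b) (by simpa using hb)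
      rw [sumCongr_zpow_apply] at hi
      exact ⟨i, by simpa using hi⟩

lemma sign_sumComm {α : Type} [Fintype α] [DecidableEq α] (h : Even (Fintype.card α)) :
    sign (Equiv.sumComm α α : Perm (α ⊕ α)) = 1 := by
  have := sign_eq_sign_of_equiv (prodCongrLeft (fun _ : α => swap true false))
    (Equiv.sumComm α α : Perm (α ⊕ α)) (Equiv.boolProdEquivSum α) (by
      rintro ⟨_ | _, a⟩ <;> simp [Equiv.boolProdEquivSum, prodCongrLeft])
  rw [← this, sign_prodCongrLeft]
  simp [h.neg_one_pow]

lemma cross_not_cycle {α : Type} [Fintype α] [DecidableEq α] (f : Perm (α ⊕ α))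
    (hs : sign f = 1) (hl : ∀ a, f a ≠ a) : ¬ f.IsCycle := by
  intro hf
  have h1 := hf.sign
  have h2 : f.support = Finset.univ := by ext a; simp [hl a]
  rw [hs, h2, Finset.card_univ, Fintype.card_sum, ← two_mul, pow_mul] at h1
  norm_num at h1

/-- The basic pieces. -/
def fam {α : Type} (p : Bool × Perm α × Perm α) : Perm (α ⊕ α) :=
  Perm.sumCongr p.2.1 (p.2.1 * p.2.2) * (if p.1 then (Equiv.sumComm α α : Perm (α ⊕ α)) else 1)

lemma step {α : Type} [Fintype α] [DecidableEq α] [Nonempty α] (h : Even (Fintype.card α)) {k : ℕ}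
    (H : GoodFam α k) : GoodFam (α ⊕ α) (2 * (Fintype.card α).factorial * k) := by
  obtain ⟨B, hB, he, hk⟩ := H
  have hsign : ∀ p : Bool × Perm α × Perm α, p.2.2 ∈ B → sign (fam p) = 1 := by
    rintro ⟨t, σ, b⟩ hb
    have hb1 := he b hb
    cases t <;> simp [fam, hb1, sign_sumComm h]
  have hdiag : ∀ σ b σ' b' : Perm α, b ∈ B → b' ∈ B → (σ, b) ≠ (σ', b') →
      ¬ ((Perm.sumCongr σ (σ * b))⁻¹ * Perm.sumCongr σ' (σ' * b')).IsCycle := by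
    intro σ b σ' b' hb hb' hne hc
    rw [sumCongr_inv, sumCongr_mul] at hc
    rcases not_isCycle_sumCongr hc with ⟨h1, h2⟩ | ⟨h1, h2⟩
    · have : σ = σ' := inv_mul_eq_one.mp h1
      subst this
      refine hB b hb b' hb' (fun e => hne (by rw [e])) ?_
      simpa [mul_assoc] using h2
    · have h3 : σ * b = σ' * b' := inv_mul_eq_one.mp h1
      by_cases e : b = b'
      · subst e
        exact hne (by rw [mul_right_cancel h3])
      · refine hB b hb b' hb' e ?_
        have h4 : σ⁻¹ * σ' = b * b'⁻¹ := by
          rw [inv_mul_eq_iff_eq_mul, ← mul_assoc, h3]; simp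
        rw [h4] at h2
        have h5 := (h2.conj (g := b⁻¹)).inv
        simpa [mul_assoc] using h5
  have hdiag1 : ∀ σ b σ' b' : Perm α, (σ, b) ≠ (σ', b') →
      Perm.sumCongr σ (σ * b) ≠ Perm.sumCongr σ' (σ' * b') := by
    intro σ b σ' b' hne e
    have := @sumCongrHom_injective α α (σ, σ * b) (σ', σ' * b') e
    simp only [Prod.mk.injEq] at this
    obtain ⟨rfl, h2⟩ := this
    exact hne (by rw [mul_left_cancel h2])
  have key : ∀ p q : Bool × Perm α × Perm α, p.2.2 ∈ B → q.2.2 ∈ B → p ≠ q →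
      fam p ≠ fam q ∧ ¬ ((fam p)⁻¹ * fam q).IsCycle := by
    have hx : ∀ p q : Bool × Perm α × Perm α, p.2.2 ∈ B → q.2.2 ∈ B → p.1 ≠ q.1 →
        fam p ≠ fam q ∧ ¬ ((fam p)⁻¹ * fam q).IsCycle := by
      intro p q hp hq hne
      have hl : ∀ a, fam p a ≠ fam q a := by
        obtain ⟨t, σ, b⟩ := p
        obtain ⟨t', σ', b'⟩ := q
        rintro (a | a) <;> cases t <;> cases t' <;> simp [fam] at hne ⊢
      have hp1 := hsign p hp
      have hq1 := hsign q hq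
      constructor
      · intro e
        exact hl (Sum.inl (Classical.arbitrary α)) (by rw [e])
      · apply cross_not_cycle
        · simp [hp1, hq1]
        · intro a ha
          rw [Perm.mul_apply, Perm.inv_eq_iff_eq] at ha
          exact hl a ha.symm
    rintro ⟨t, σ, b⟩ ⟨t', σ', b'⟩ hp hq hne
    by_cases ht : t = t'
    · subst ht
      have hne' : (σ, b) ≠ (σ', b') := fun e => hne (by rw [e])
      refine ⟨fun e => hdiag1 σ b σ' b' hne' (mul_right_cancel e), fun hc => ?_⟩
      refine hdiag σ b σ' b' hp hq hne' ?_
      have := hc.conj (g := if t then (Equiv.sumComm α α : Perm (α ⊕ α)) else 1)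
      simpa only [fam, mul_inv_rev, mul_assoc, mul_inv_cancel_left, mul_inv_cancel, mul_one]
        using this
    · exact hx _ _ hp hq ht
  classical
  refine ⟨((Finset.univ : Finset Bool) ×ˢ ((Finset.univ : Finset (Perm α)) ×ˢ B)).image fam,
    ?_, ?_, ?_⟩
  · simp only [Finset.mem_image, Finset.mem_product, Finset.mem_univ, true_and]
    rintro _ ⟨p, hp, rfl⟩ _ ⟨q, hq, rfl⟩ hne
    exact (key p q hp hq (fun e => hne (by rw [e]))).2
  · simp only [Finset.mem_image, Finset.mem_product, Finset.mem_univ, true_and]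
    rintro _ ⟨p, hp, rfl⟩
    exact hsign p hp
  · rw [Finset.card_image_of_injOn]
    · simp [Finset.card_product, Fintype.card_perm, hk, mul_assoc]
    · intro p hp q hq e
      by_contra hne
      exact (key p q (by simpa using hp) (by simpa using hq) hne).1 e

lemma transport {α β : Type} [Fintype α] [DecidableEq α] [Fintype β] [DecidableEq β]
    (e : α ≃ β) {k : ℕ} (H : GoodFam α k) : GoodFam β k := by
  obtain ⟨B, hB, he, hk⟩ := H
  refine ⟨B.map e.permCongr.toEmbedding, ?_, ?_, ?_⟩
  · simp only [Finset.mem_map_equiv]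
    intro σ hσ τ hτ hne hc
    refine hB _ hσ _ hτ (fun h => hne (e.permCongr.symm.injective h)) ?_
    obtain ⟨z, hz, hw⟩ := hc
    have h0 : (e.permCongr.symm σ)⁻¹ * e.permCongr.symm τ = e.permCongrHom.symm (σ⁻¹ * τ) := by
      rw [map_mul, map_inv]; rfl
    rw [h0]
    have hap : ∀ (f : Perm β) (a : α), e.permCongrHom.symm f a = e.symm (f (e a)) :=
      fun f a => rfl
    refine ⟨e.symm z, ?_, ?_⟩
    · rw [hap]; simpa using hz
    · intro a ha
      rw [hap, Ne, Equiv.symm_apply_eq] at ha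
      obtain ⟨i, hi⟩ := hw (y := e a) ha
      refine ⟨i, ?_⟩
      rw [← map_zpow, hap, Equiv.apply_symm_apply, hi, Equiv.symm_apply_apply]
  · simp only [Finset.mem_map_equiv]
    intro σ hσ
    have := he _ hσ
    simpa using this
  · simpa using hk

lemma cb (n : ℕ) : (Nat.centralBinom n) ^ 2 * (3 * n + 1) ≤ 16 ^ n := by
  induction n with
  | zero => simp
  | succ n ih =>
    have h := Nat.succ_mul_centralBinom_succ n
    have h2 : (n + 1) ^ 2 * (Nat.centralBinom (n + 1) ^ 2 * (3 * (n + 1) + 1)) ≤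
        (n + 1) ^ 2 * 16 ^ (n + 1) := by
      calc _ = ((n + 1) * Nat.centralBinom (n + 1)) ^ 2 * (3 * (n + 1) + 1) := by ring
        _ = Nat.centralBinom n ^ 2 * (4 * ((2 * n + 1) ^ 2 * (3 * n + 4))) := by rw [h]; ring
        _ ≤ Nat.centralBinom n ^ 2 * (4 * (4 * (n + 1) ^ 2 * (3 * n + 1))) := by
          have : (2 * n + 1) ^ 2 * (3 * n + 4) ≤ 4 * (n + 1) ^ 2 * (3 * n + 1) := by nlinarith
          exact Nat.mul_le_mul_left _ (Nat.mul_le_mul_left _ this)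
        _ = (Nat.centralBinom n ^ 2 * (3 * n + 1)) * (16 * (n + 1) ^ 2) := by ring
        _ ≤ 16 ^ n * (16 * (n + 1) ^ 2) := by gcongr
        _ = _ := by ring
    exact Nat.le_of_mul_le_mul_left h2 (by positivity)

/-- The sizes. -/
def bsz : ℕ → ℕ
  | 0 => 1
  | (m + 1) => 2 * (2 ^ (m + 1)).factorial * bsz m

lemma good (m : ℕ) : GoodFam (Fin (2 ^ (m + 1))) (bsz m) := by
  induction m with
  | zero => exact ⟨{1}, by simp, by simp, by simp [bsz]⟩
  | succ m ih =>
    have h := step (by simp [pow_succ]) ih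
    rw [Fintype.card_fin] at h
    exact transport (finSumFinEquiv.trans (finCongr (by ring))) h

/-- fourth power of `2^((m+1)(m+7)/4) * 2` -/
lemma size (m : ℕ) : (2 : ℝ) ^ ((((m : ℝ) + 1) * (7 + m)) / 4) * (Nat.factorial (2 ^ (m + 1))) * 2
      ≤ bsz m * 4 ^ (2 ^ (m + 1)) := by
  induction m with
  | zero =>
    have : (2 : ℝ) ^ ((7 : ℝ) / 4) ≤ 2 ^ (2 : ℝ) :=
      Real.rpow_le_rpow_of_exponent_le (by norm_num) (by norm_num)
    norm_num [bsz] at this ⊢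
    linarith
  | succ m ih =>
    set n := 2 ^ (m + 1) with hn
    have hc := cb n
    have hf : Nat.factorial (2 ^ (m + 1 + 1)) = Nat.centralBinom n * n.factorial * n.factorial := by
      have := Nat.centralBinom_eq_two_mul_choose n
      rw [this, show 2 ^ (m + 1 + 1) = 2 * n by rw [hn]; ring]
      have h2 := Nat.choose_mul_factorial_mul_factorial (show n ≤ 2 * n by omega)
      rw [show 2 * n - n = n by omega] at h2
      exact h2.symm
    have hexp : (2 : ℝ) ^ ((((m + 1 : ℕ) : ℝ) + 1) * (7 + (m + 1 : ℕ)) / 4) =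
        (2 : ℝ) ^ ((((m : ℝ) + 1) * (7 + m)) / 4) * (2 : ℝ) ^ (((m : ℝ) + 1) / 2 + 7 / 4) := by
      rw [← Real.rpow_add (by norm_num)]
      congr 1
      push_cast
      ring
    set X := (2 : ℝ) ^ (((m : ℝ) + 1) / 2 + 7 / 4) with hX
    have hX0 : 0 < X := by positivity
    have hX2 : X ^ 2 = n * 2 ^ ((7 : ℝ) / 2) := by
      rw [hX, ← Real.rpow_natCast, ← Real.rpow_mul (by norm_num),
        show (((m : ℝ) + 1) / 2 + 7 / 4) * (2 : ℕ) = ((m + 1 : ℕ) : ℝ) + 7 / 2 by push_cast; ring,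
        Real.rpow_add (by norm_num), Real.rpow_natCast, hn]
      push_cast
      rfl
    have h72 : (2 : ℝ) ^ ((7 : ℝ) / 2) ≤ 12 := by
      have h0 : (0 : ℝ) ≤ 2 ^ ((7 : ℝ) / 2) := by positivity
      have : ((2 : ℝ) ^ ((7 : ℝ) / 2)) ^ 2 = 128 := by
        rw [← Real.rpow_natCast, ← Real.rpow_mul (by norm_num)]
        norm_num
      nlinarith
    have hmain : X * Nat.centralBinom n ≤ 2 * 4 ^ n := by
      refine (pow_le_pow_iff_left₀ (by positivity) (by positivity) two_ne_zero).mp ?_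
      have hc' : (Nat.centralBinom n : ℝ) ^ 2 * (3 * n + 1) ≤ 16 ^ n := by exact_mod_cast hc
      calc (X * Nat.centralBinom n) ^ 2 = (Nat.centralBinom n : ℝ) ^ 2 * (n * 2 ^ ((7 : ℝ) / 2)) := by
            rw [mul_pow, hX2]; ring
        _ ≤ (Nat.centralBinom n : ℝ) ^ 2 * (n * 12) := by gcongr
        _ ≤ 4 * ((Nat.centralBinom n : ℝ) ^ 2 * (3 * n + 1)) := by
            nlinarith [sq_nonneg (Nat.centralBinom n : ℝ)]
        _ ≤ 4 * 16 ^ n := by gcongr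
        _ = _ := by rw [mul_pow, ← pow_mul, mul_comm n 2, pow_mul]; norm_num
    rw [hexp, hf, show 2 ^ (m + 1 + 1) = n + n by rw [hn]; ring, pow_add]
    simp only [bsz, ← hn]
    push_cast
    set E := (2 : ℝ) ^ ((((m : ℝ) + 1) * (7 + m)) / 4)
    calc E * X * (Nat.centralBinom n * n.factorial * n.factorial) * 2
        = (E * n.factorial * 2) * (X * Nat.centralBinom n) * n.factorial := by ring
      _ ≤ (bsz m * 4 ^ n) * (2 * 4 ^ n) * n.factorial := by gcongr
      _ = _ := by ring

/-- Proposition 4.6: for `n = 2^m` (`m ≥ 2`) there is an independent set `B` of `G(Ω_n)`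
of even permutations with `|B| ≥ n^((6 + log₂ n)/4) · n!/2^(2n-1)`. -/
theorem stmt17 (m : ℕ) (hm : 2 ≤ m) :
    ∃ B : Finset (Equiv.Perm (Fin (2 ^ m))),
      IsBIndep (B : Set (Equiv.Perm (Fin (2 ^ m)))) ∧
      (∀ σ ∈ B, Equiv.Perm.sign σ = 1) ∧
      ((2 ^ m : ℝ) ^ (((6 : ℝ) + m) / 4) * (Nat.factorial (2 ^ m)) /
        2 ^ (2 * 2 ^ m - 1) ≤ (B.card : ℝ)) := by
  obtain ⟨k, rfl⟩ : ∃ k, m = k + 1 := ⟨m - 1, by omega⟩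
  obtain ⟨B, h1, h2, h3⟩ := good k
  refine ⟨B, fun σ hσ τ hτ hne => h1 σ hσ τ hτ hne, h2, ?_⟩
  have hs := size k
  rw [h3, div_le_iff₀ (by positivity)]
  have e1 : ((2 : ℝ) ^ (k + 1)) ^ (((6 : ℝ) + (k + 1 : ℕ)) / 4) =
      (2 : ℝ) ^ ((((k : ℝ) + 1) * (7 + k)) / 4) := by
    rw [← Real.rpow_natCast, ← Real.rpow_mul (by norm_num)]
    congr 1
    push_cast
    ring
  have e2 : (4 : ℝ) ^ (2 ^ (k + 1)) = 2 ^ (2 * 2 ^ (k + 1) - 1) * 2 := by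
    rw [← pow_succ, Nat.sub_add_cancel (by have := Nat.two_pow_pos (k + 1); omega), pow_mul]
    norm_num
  rw [e1]
  rw [e2] at hs
  linarith
end

section
/- Let n and k be integers with n ≥ k ≥ 4. Then the Birkhoff polytope graph G(Ω_n) contains a clique of size ⌊(n−k+2)²/4⌋ all of whose elements are cycles of length k; in particular, the maximum size of a clique consisting of cycles of length k is at least ⌊(n−k+2)²/4⌋. -/
/-- Two permutations `σ`, `τ` are adjacent in the Birkhoff polytope graph `G(Ω_n)` iff
`σ⁻¹ * τ` is a cycle.  A clique is a set of pairwise adjacent permutations. -/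
def IsBClique {n : ℕ} (S : Set (Equiv.Perm (Fin n))) : Prop :=
  S.Pairwise fun σ τ => (σ⁻¹ * τ).IsCycle

open Equiv in
theorem adj_aux {α : Type*} [DecidableEq α] (q i j i' j' : α)
    (hqi : q ≠ i) (hqj : q ≠ j) (hqi' : q ≠ i') (hqj' : q ≠ j')
    (hij : i ≠ j) (hij' : i ≠ j') (hi'j : i' ≠ j) (hi'j' : i' ≠ j')
    (h : ¬ (i = i' ∧ j = j')) :
    (swap j q * swap i j * swap i' j' * swap j' q).IsCycle := by
  by_cases h1 : i = i'
  · subst h1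
    have h2 : j ≠ j' := fun e => h ⟨rfl, e⟩
    have e : swap j q * swap i j * swap i j' * swap j' q = List.formPerm [i, j', j] := by
      ext x
      simp only [List.formPerm_cons_cons, List.formPerm_singleton, Perm.mul_apply, Perm.one_apply,
        swap_apply_def]
      grind
    rw [e]
    exact List.isCycle_formPerm (by simp; tauto) (by simp)
  · by_cases h2 : j = j'
    · subst h2
      have e : swap j q * swap i j * swap i' j * swap j q = List.formPerm [q, i', i] := by
        ext x
        simp only [List.formPerm_cons_cons, List.formPerm_singleton, Perm.mul_apply, Perm.one_apply,
          swap_apply_def]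
        grind
      rw [e]
      exact List.isCycle_formPerm (by simp; tauto) (by simp)
    · have e : swap j q * swap i j * swap i' j' * swap j' q
          = List.formPerm [q, i', j', j, i] := by
        ext x
        simp only [List.formPerm_cons_cons, List.formPerm_singleton, Perm.mul_apply, Perm.one_apply,
          swap_apply_def]
        grind
      rw [e]
      exact List.isCycle_formPerm (by simp; grind) (by simp)

open Equiv in
theorem adj_form {α : Type*} [DecidableEq α] (l : List α) (q i j i' j' : α)
    (hqi : q ≠ i) (hqj : q ≠ j) (hqi' : q ≠ i') (hqj' : q ≠ j')
    (hij : i ≠ j) (hij' : i ≠ j') (hi'j : i' ≠ j) (hi'j' : i' ≠ j')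
    (h : ¬ (i = i' ∧ j = j')) :
    ((List.formPerm (i :: j :: q :: l))⁻¹ * List.formPerm (i' :: j' :: q :: l)).IsCycle := by
  have := (adj_aux q i j i' j' hqi hqj hqi' hqj' hij hij' hi'j hi'j' h).conj
    (g := (List.formPerm (q :: l))⁻¹)
  convert this using 1
  simp only [List.formPerm_cons_cons i, List.formPerm_cons_cons i', List.formPerm_cons_cons j,
    List.formPerm_cons_cons j', mul_inv_rev, swap_inv, inv_inv, mul_assoc]

/-- Proposition A.1: for `n ≥ k ≥ 4`, `G(Ω_n)` contains a clique of size
`⌊(n-k+2)²/4⌋` all of whose elements are cycles of length `k`. -/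
theorem stmt18 (n k : ℕ) (hk : 4 ≤ k) (hkn : k ≤ n) :
    ∃ S : Finset (Equiv.Perm (Fin n)),
      IsBClique (S : Set (Equiv.Perm (Fin n))) ∧
      (∀ σ ∈ S, Equiv.Perm.IsCycle σ ∧ σ.support.card = k) ∧
      S.card = (n - k + 2) ^ 2 / 4 := by
  obtain ⟨r, rfl⟩ : ∃ r, k = r + 3 := ⟨k - 3, by omega⟩
  obtain ⟨m, hm⟩ : ∃ m, m = n - (r + 3) + 2 := ⟨_, rfl⟩
  rw [← hm]
  obtain ⟨a, b, hab, hmul⟩ : ∃ a b, a + b = m ∧ a * b = m ^ 2 / 4 := by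
    rcases Nat.even_or_odd' m with ⟨c, rfl | rfl⟩
    · refine ⟨c, c, by ring, ?_⟩
      have : (2 * c) ^ 2 = 4 * (c * c) := by ring
      omega
    · refine ⟨c, c + 1, by ring, ?_⟩
      have : (2 * c + 1) ^ 2 = 4 * (c * (c + 1)) + 1 := by ring
      omega
  let q : Fin n := ⟨m, by omega⟩
  let l : List (Fin n) := List.ofFn (fun x : Fin r => (⟨m + 1 + x, by omega⟩ : Fin n))
  let e : Fin a → Fin n := fun i => ⟨i, by omega⟩
  let f : Fin b → Fin n := fun j => ⟨a + j, by omega⟩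
  let s : Fin a × Fin b → Equiv.Perm (Fin n) := fun p =>
    List.formPerm (e p.1 :: f p.2 :: q :: l)
  have hadj : ∀ p p', p ≠ p' → ((s p)⁻¹ * s p').IsCycle := by
    rintro ⟨i, j⟩ ⟨i', j'⟩ h
    have h' : ¬ (i = i' ∧ j = j') := fun ⟨h1, h2⟩ => h (by rw [h1, h2])
    apply adj_form <;> simp only [q, e, f, ne_eq, Fin.mk.injEq] <;> omega
  have hnd : ∀ p : Fin a × Fin b, (e p.1 :: f p.2 :: q :: l).Nodup := by
    rintro ⟨i, j⟩
    have hl : l.Nodup := by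
      rw [List.nodup_ofFn]
      intro x y h
      simp only [Fin.mk.injEq] at h
      omega
    simp only [List.nodup_cons, List.mem_cons, not_or, hl, l, List.mem_ofFn, e, f, q,
      Fin.mk.injEq, not_exists]
    refine ⟨⟨by omega, by omega, fun x => by omega⟩, ⟨by omega, fun x => by omega⟩,
      fun x => by omega, ?_⟩
    trivial
  have hinj : Function.Injective s := by
    intro p p' h
    by_contra hne
    have := hadj p p' hne
    rw [h, inv_mul_cancel] at this
    exact this.ne_one rfl
  refine ⟨Finset.univ.image s, ?_, ?_, ?_⟩
  · intro σ hσ τ hτ hne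
    simp only [Finset.coe_image, Finset.coe_univ, Set.image_univ, Set.mem_range] at hσ hτ
    obtain ⟨p, rfl⟩ := hσ
    obtain ⟨p', rfl⟩ := hτ
    exact hadj p p' (fun h => hne (by rw [h]))
  · intro σ hσ
    simp only [Finset.mem_image, Finset.mem_univ, true_and] at hσ
    obtain ⟨p, rfl⟩ := hσ
    refine ⟨List.isCycle_formPerm (hnd p) (by simp), ?_⟩
    rw [List.support_formPerm_of_nodup _ (hnd p) (by simp), List.toFinset_card_of_nodup (hnd p)]
    simp [l]
  · rw [Finset.card_image_of_injective _ hinj]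
    simp [hmul]
end

section
/- The independence number of the Birkhoff polytope graph satisfies α(3) = 1 and α(4) = 4. Moreover, a subset S of Sym(4) is a maximum independent set of G(Ω_4) (i.e., an independent set of size 4) if and only if S is a coset of the subgroup H = {id, (1,2)(3,4), (1,3)(2,4), (1,4)(2,3)} of Sym(4). -/
/-- The Klein four-subgroup `H = {id, (1,2)(3,4), (1,3)(2,4), (1,4)(2,3)}` of `Sym(4)`
(written with 0-based points). -/
def H4 : Set (Equiv.Perm (Fin 4)) :=
  {1, Equiv.swap 0 1 * Equiv.swap 2 3, Equiv.swap 0 2 * Equiv.swap 1 3,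
   Equiv.swap 0 3 * Equiv.swap 1 2}

def K4 : Finset (Equiv.Perm (Fin 4)) :=
  {1, Equiv.swap 0 1 * Equiv.swap 2 3, Equiv.swap 0 2 * Equiv.swap 1 3,
   Equiv.swap 0 3 * Equiv.swap 1 2}

lemma coe_K4 : (K4 : Set (Equiv.Perm (Fin 4))) = H4 := by
  simp [K4, H4]

lemma card_K4 : K4.card = 4 := by decide

set_option maxRecDepth 100000 in
lemma cycle3 : ∀ g : Equiv.Perm (Fin 3), g ≠ 1 → g.IsCycle := by
  unfold Equiv.Perm.IsCycle
  decide

set_option maxRecDepth 100000 in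
set_option maxHeartbeats 4000000 in
lemma cycle4 : ∀ g : Equiv.Perm (Fin 4), ¬ g.IsCycle ↔ g ∈ K4 := by
  unfold Equiv.Perm.IsCycle
  decide

lemma K4_closed : ∀ g ∈ K4, ∀ h ∈ K4, g⁻¹ * h ∈ K4 := by decide

lemma indep_coset (τ : Equiv.Perm (Fin 4)) :
    IsBIndep ((fun x => τ * x) '' H4) := by
  rintro _ ⟨g, hg, rfl⟩ _ ⟨h, hh, rfl⟩ _
  rw [← coe_K4, Finset.mem_coe] at hg hh
  have e : (τ * g)⁻¹ * (τ * h) = g⁻¹ * h := by group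
  simp only [e]
  exact (cycle4 _).2 (K4_closed g hg h hh)

lemma sub_coset (S : Finset (Equiv.Perm (Fin 4)))
    (hS : IsBIndep (S : Set (Equiv.Perm (Fin 4)))) (σ) (hσ : σ ∈ S) :
    S ⊆ K4.image (fun x => σ * x) := by
  intro τ hτ
  rw [Finset.mem_image]
  refine ⟨σ⁻¹ * τ, ?_, by group⟩
  by_cases h : σ = τ
  · subst h
    simp [K4]
  · exact (cycle4 _).1 (hS hσ hτ h)

lemma card_coset (σ : Equiv.Perm (Fin 4)) : (K4.image (fun x => σ * x)).card = 4 := by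
  rw [Finset.card_image_of_injective _ (mul_right_injective σ), card_K4]

/-- Proposition A.3: `α(3) = 1` and `α(4) = 4`; moreover a subset of `Sym(4)` is a
maximum independent set of `G(Ω_4)` (an independent set of size 4) iff it is a coset
of the Klein four-subgroup `H`. -/
theorem stmt19 :
    birkhoffIndepNum 3 = 1 ∧ birkhoffIndepNum 4 = 4 ∧
    (∀ S : Finset (Equiv.Perm (Fin 4)),
      (IsBIndep (S : Set (Equiv.Perm (Fin 4))) ∧ S.card = 4) ↔
      ∃ τ : Equiv.Perm (Fin 4),
        (S : Set (Equiv.Perm (Fin 4))) = (fun x => τ * x) '' H4) := by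
  refine ⟨?_, ?_, ?_⟩
  · refine IsGreatest.csSup_eq ⟨⟨{1}, by simp [IsBIndep], by simp⟩, ?_⟩
    rintro k ⟨S, hS, rfl⟩
    rw [Finset.card_le_one]
    intro a ha b hb
    by_contra h
    refine hS ha hb h (cycle3 _ ?_)
    rwa [Ne, inv_mul_eq_one]
  · refine IsGreatest.csSup_eq ⟨⟨K4.image (fun x => 1 * x), ?_, card_coset 1⟩, ?_⟩
    · rw [Finset.coe_image, coe_K4]
      exact indep_coset 1
    · rintro k ⟨S, hS, rfl⟩
      rcases S.eq_empty_or_nonempty with rfl | ⟨σ, hσ⟩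
      · simp
      · exact (Finset.card_le_card (sub_coset S hS σ hσ)).trans (card_coset σ).le
  · intro S
    constructor
    · rintro ⟨hS, hc⟩
      obtain ⟨σ, hσ⟩ : S.Nonempty := Finset.card_pos.1 (by omega)
      refine ⟨σ, ?_⟩
      rw [Finset.eq_of_subset_of_card_le (sub_coset S hS σ hσ) (by rw [card_coset, hc]),
        Finset.coe_image, coe_K4]
    · rintro ⟨τ, h⟩
      refine ⟨h ▸ indep_coset τ, ?_⟩
      have : S = K4.image (fun x => τ * x) := by
        apply Finset.coe_injective
        rw [h, Finset.coe_image, coe_K4]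
      rw [this, card_coset]
end
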